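/- arXiv:1711.01240 — 2 statements merged into one kernel-verified Lean document; each statement's English description precedes it below -/
import Mathlib

section
/- (Rørdam's lemma, exact form) Let A be a C*-algebra and let a, b ∈ A satisfy 0 ≤ a ≤ 1, 0 ≤ b ≤ 1, and ‖a − b‖ < δ/2 for some δ ∈ (0,1). Then there exists z ∈ A with ‖z‖ ≤ 1 such that (a − δ)₊ = z* b z. -/
section PositiveFactorization

variable {A : Type*} [NonUnitalCStarAlgebra A] [PartialOrder A] [StarOrderedRing A]

/-- Conjugation by `1 - p` in the unitization, written out inside the algebra, is monotone. -/
lemma sub_conjugate_nonneg {x : A} (hx : 0 ≤ x) {p : A} (hp : IsSelfAdjoint p) :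
    0 ≤ x - p * x - x * p + p * x * p := by
  obtain ⟨y, rfl⟩ := CStarAlgebra.nonneg_iff_eq_star_mul_self.mp hx
  have h := star_mul_self_nonneg (y - y * p)
  rw [star_sub, star_mul, hp.star_eq] at h
  convert h using 1
  noncomm_ring

lemma norm_mul_sq_le_of_sq_le {c d h k : A} (hd : IsSelfAdjoint d) (hdc : d * d = c)
    (hc : 0 ≤ c) (hch : c ≤ h) (hk : IsSelfAdjoint k) : ‖k * d‖ ^ 2 ≤ ‖k * h * k‖ := by
  have h1 : (k * d) * star (k * d) = k * c * k := by
    rw [star_mul, hk.star_eq, hd.star_eq, ← hdc]; noncomm_ring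
  rw [sq, ← CStarRing.norm_self_mul_star, h1]
  exact CStarAlgebra.norm_le_norm_of_nonneg_of_le (hk.conjugate_nonneg hc)
    (hk.conjugate_le_conjugate hch)

lemma norm_sub_mul_sq_le_of_sq_le {c d h p : A} (hd : IsSelfAdjoint d) (hdc : d * d = c)
    (hc : 0 ≤ c) (hch : c ≤ h) (hp : IsSelfAdjoint p) :
    ‖d - d * p‖ ^ 2 ≤ ‖h - p * h - h * p + p * h * p‖ := by
  have h1 : star (d - d * p) * (d - d * p) = c - p * c - c * p + p * c * p := by
    rw [star_sub, star_mul, hp.star_eq, hd.star_eq, ← hdc]; noncomm_ring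
  rw [sq, ← CStarRing.norm_star_mul_self, h1]
  refine CStarAlgebra.norm_le_norm_of_nonneg_of_le (sub_conjugate_nonneg hc hp) ?_
  rw [← sub_nonneg]
  convert sub_conjugate_nonneg (sub_nonneg.mpr hch) hp using 1
  noncomm_ring

/-- A continuous approximation, vanishing at `0`, of `t ↦ t ^ (-1/2)` on `[0, ∞)`. -/
noncomputable def approxInvSqrt (s t : ℝ) : ℝ := √t / (|t| + s ^ 2)

lemma approxInvSqrt_zero (s : ℝ) : approxInvSqrt s 0 = 0 := by simp [approxInvSqrt]

lemma continuous_approxInvSqrt {s : ℝ} (hs : 0 < s) : Continuous (approxInvSqrt s) := by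
  unfold approxInvSqrt
  exact Real.continuous_sqrt.div (by fun_prop) fun t => by positivity

lemma mul_approxInvSqrt_sq_le_one {s t : ℝ} (hs : 0 < s) (ht : 0 ≤ t) :
    t * approxInvSqrt s t ^ 2 ≤ 1 := by
  rw [approxInvSqrt, abs_of_nonneg ht, div_pow, Real.sq_sqrt ht, ← mul_div_assoc,
    div_le_one (by positivity)]
  nlinarith [sq_nonneg s, mul_nonneg ht (sq_nonneg s), sq_nonneg (s ^ 2)]

lemma mul_one_sub_approxInvSqrt_sq_le {s t : ℝ} (hs : 0 < s) (ht : 0 ≤ t) :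
    t * (1 - t * approxInvSqrt s t ^ 2) ≤ 2 * s ^ 2 := by
  rw [approxInvSqrt, abs_of_nonneg ht, div_pow, Real.sq_sqrt ht]
  have h : t * (1 - t * (t / (t + s ^ 2) ^ 2)) =
      (t * (2 * t * s ^ 2 + s ^ 4)) / (t + s ^ 2) ^ 2 := by
    have : t + s ^ 2 ≠ 0 := by positivity
    field_simp
    ring
  rw [h, div_le_iff₀ (by positivity)]
  have : 0 ≤ t * s ^ 4 := by positivity
  have : 0 ≤ s ^ 6 := by positivity
  nlinarith

lemma sqrt_sub_mul_approxInvSqrt_bounds {s t : ℝ} (hs : 0 < s) (ht : 0 ≤ t) :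
    0 ≤ √t - t * approxInvSqrt s t ∧ √t - t * approxInvSqrt s t ≤ s := by
  rw [approxInvSqrt, abs_of_nonneg ht]
  have h : √t - t * (√t / (t + s ^ 2)) = √t * s ^ 2 / (t + s ^ 2) := by
    have : t + s ^ 2 ≠ 0 := by positivity
    field_simp
    ring
  rw [h]
  refine ⟨by positivity, ?_⟩
  rw [div_le_iff₀ (by positivity)]
  have h2 := Real.sq_sqrt ht
  have h3 : √t * s ≤ t + s ^ 2 := by nlinarith [sq_nonneg (√t - s), sq_nonneg (√t + s)]
  nlinarith [mul_le_mul_of_nonneg_right h3 hs.le]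

/-- If `0 ≤ c ≤ w* b w` and `w* b w` dominates a multiple of `w* w`, then `c = z* b z` with
`‖z‖ ≤ ‖w‖`. -/
lemma exists_star_mul_mul_eq_of_le {b c w : A} {K : ℝ} (hc : 0 ≤ c)
    (hcw : c ≤ star w * b * w) (hK : 0 ≤ K) (hw : star w * w ≤ K • (star w * b * w)) :
    ∃ z : A, ‖z‖ ≤ ‖w‖ ∧ c = star z * b * z := by
  obtain ⟨d, hd, hdc⟩ : ∃ d : A, IsSelfAdjoint d ∧ d * d = c :=
    ⟨CFC.sqrt c, (CFC.sqrt_nonneg c).isSelfAdjoint, CFC.sqrt_mul_sqrt_self c hc⟩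
  set h := star w * b * w with hh
  have h0 : 0 ≤ h := hc.trans hcw
  have hsa : IsSelfAdjoint h := h0.isSelfAdjoint
  have hspec : ∀ t ∈ quasispectrum ℝ h, 0 ≤ t := fun t ht =>
    quasispectrum_nonneg_of_nonneg h h0 t ht
  let s : ℕ → ℝ := fun n => 1 / ((n : ℝ) + 1)
  have hs : ∀ n, 0 < s n := fun n => Nat.one_div_pos_of_nat
  have hs0 : Filter.Tendsto s Filter.atTop (nhds 0) := tendsto_one_div_add_atTop_nhds_zero_nat
  let g : ℕ → A := fun n => cfcₙ (approxInvSqrt (s n)) h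
  have hg : ∀ n, IsSelfAdjoint (g n) := fun n => cfcₙ_predicate _ h
  have hcont : ∀ n, ContinuousOn (approxInvSqrt (s n)) (quasispectrum ℝ h) :=
    fun n => (continuous_approxInvSqrt (hs n)).continuousOn
  have hz0 : ∀ n, approxInvSqrt (s n) 0 = 0 := fun n => approxInvSqrt_zero _
  have hconj : ∀ f : ℝ → ℝ, ContinuousOn f (quasispectrum ℝ h) → f 0 = 0 →
      cfcₙ f h * h * cfcₙ f h = cfcₙ (fun t => f t * t * f t) h := by
    intro f hf hf0
    rw [cfcₙ_mul (fun t => f t * t) f h (hf.mul continuousOn_id) (by simp) hf hf0,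
      cfcₙ_mul f (fun t => t) h hf hf0 continuousOn_id rfl, cfcₙ_id' ℝ h hsa]
  let z : ℕ → A := fun n => w * g n * d
  have hzn : ∀ n, ‖z n‖ ≤ ‖w‖ := by
    intro n
    have h1 : ‖g n * d‖ ^ 2 ≤ 1 := by
      refine (norm_mul_sq_le_of_sq_le hd hdc hc hcw (hg n)).trans ?_
      rw [hconj _ (hcont n) (hz0 n)]
      refine norm_cfcₙ_le fun t ht => ?_
      have ht := hspec t ht
      have := mul_approxInvSqrt_sq_le_one (hs n) ht
      rw [Real.norm_of_nonneg (by nlinarith [mul_nonneg ht (sq_nonneg (approxInvSqrt (s n) t))])]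
      linarith
    have h2 : ‖g n * d‖ ≤ 1 := by nlinarith [norm_nonneg (g n * d)]
    calc ‖w * g n * d‖ = ‖w * (g n * d)‖ := by rw [mul_assoc]
      _ ≤ ‖w‖ * ‖g n * d‖ := norm_mul_le _ _
      _ ≤ ‖w‖ := mul_le_of_le_one_right (norm_nonneg _) h2
  have hdiff : ∀ N n m, N ≤ n → N ≤ m → ‖z n - z m‖ ≤ √K * s N := by
    intro N n m hn hm
    have hsn : s n ≤ s N := Nat.one_div_le_one_div hn
    have hsm : s m ≤ s N := Nat.one_div_le_one_div hm
    let f : ℝ → ℝ := fun t => approxInvSqrt (s n) t - approxInvSqrt (s m) t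
    have hf : ContinuousOn f (quasispectrum ℝ h) := (hcont n).sub (hcont m)
    have hf0 : f 0 = 0 := by simp [f, hz0]
    have hgf : g n - g m = cfcₙ f h :=
      (cfcₙ_sub _ _ h (hcont n) (hz0 n) (hcont m) (hz0 m)).symm
    let k : ℝ → ℝ := fun t => √t * f t
    have hk : ContinuousOn k (quasispectrum ℝ h) := Real.continuous_sqrt.continuousOn.mul hf
    have hk0 : k 0 = 0 := by simp [k]
    have hk2 : cfcₙ f h * h * cfcₙ f h = cfcₙ k h * cfcₙ k h := by
      rw [hconj f hf hf0, ← cfcₙ_mul k k h hk hk0 hk hk0]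
      refine cfcₙ_congr fun t ht => ?_
      have := Real.mul_self_sqrt (hspec t ht)
      simp only [k]
      linear_combination (-(f t) ^ 2) * this
    have hksa : IsSelfAdjoint (cfcₙ k h) := cfcₙ_predicate _ h
    have hfsa : IsSelfAdjoint (cfcₙ f h) := cfcₙ_predicate _ h
    have hkd : ‖cfcₙ k h * d‖ ^ 2 ≤ s N ^ 2 := by
      refine (norm_mul_sq_le_of_sq_le hd hdc hc hcw hksa).trans ?_
      rw [hconj k hk hk0]
      refine norm_cfcₙ_le fun t ht => ?_
      have ht := hspec t ht
      have h1 := sqrt_sub_mul_approxInvSqrt_bounds (hs n) ht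
      have h2 := sqrt_sub_mul_approxInvSqrt_bounds (hs m) ht
      have h3 : k t * t * k t = (t * f t) ^ 2 := by
        have := Real.mul_self_sqrt ht
        simp only [k]
        linear_combination (t * (f t) ^ 2) * this
      rw [h3, Real.norm_of_nonneg (sq_nonneg _)]
      refine sq_le_sq' ?_ ?_ <;> simp only [f] <;> linarith
    have hzz : z n - z m = w * (cfcₙ f h * d) := by
      simp only [z, ← hgf]; noncomm_ring
    have hsq : ‖z n - z m‖ ^ 2 ≤ K * s N ^ 2 := by
      rw [sq, ← CStarRing.norm_star_mul_self, hzz]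
      have e1 : star (w * (cfcₙ f h * d)) * (w * (cfcₙ f h * d))
          = star (cfcₙ f h * d) * (star w * w) * (cfcₙ f h * d) := by
        rw [star_mul w]; noncomm_ring
      have e2 : star (cfcₙ f h * d) * (K • h) * (cfcₙ f h * d)
          = K • (star (cfcₙ k h * d) * (cfcₙ k h * d)) := by
        rw [mul_smul_comm, smul_mul_assoc, star_mul, star_mul, hfsa.star_eq, hksa.star_eq,
          hd.star_eq]
        congr 1
        calc d * cfcₙ f h * h * (cfcₙ f h * d) = d * (cfcₙ f h * h * cfcₙ f h) * d := by
              noncomm_ring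
          _ = d * cfcₙ k h * (cfcₙ k h * d) := by rw [hk2]; noncomm_ring
      have e3 := star_left_conjugate_le_conjugate hw (cfcₙ f h * d)
      rw [e2, ← e1] at e3
      refine (CStarAlgebra.norm_le_norm_of_nonneg_of_le (star_mul_self_nonneg _) e3).trans ?_
      rw [norm_smul, Real.norm_of_nonneg hK, CStarRing.norm_star_mul_self, ← sq]
      gcongr
    refine le_of_sq_le_sq ?_ (by have := hs N; positivity)
    rwa [mul_pow, Real.sq_sqrt hK]
  have hcau : CauchySeq z := by
    refine cauchySeq_of_le_tendsto_0 (fun N => √K * s N)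
      (fun n m N hn hm => by rw [dist_eq_norm]; exact hdiff N n m hn hm) ?_
    simpa using hs0.const_mul (√K)
  obtain ⟨y, hy⟩ := cauchySeq_tendsto_of_complete hcau
  refine ⟨y, le_of_tendsto hy.norm (Filter.Eventually.of_forall hzn), ?_⟩
  have hlim1 : Filter.Tendsto (fun n => star (z n) * b * z n) Filter.atTop
      (nhds (star y * b * y)) := (hy.star.mul_const b).mul hy
  refine tendsto_nhds_unique ?_ hlim1
  have hbound : ∀ n, ‖star (z n) * b * z n - c‖ ≤ √2 * s n * ‖d‖ := by
    intro n
    let φ : ℝ → ℝ := fun t => approxInvSqrt (s n) t * t * approxInvSqrt (s n) t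
    have hφ : ContinuousOn φ (quasispectrum ℝ h) := ((hcont n).mul continuousOn_id).mul (hcont n)
    have hφ0 : φ 0 = 0 := by simp [φ]
    have hp : IsSelfAdjoint (cfcₙ φ h) := cfcₙ_predicate _ h
    have e1 : star (z n) * b * z n - c = -((d - d * cfcₙ φ h) * d) := by
      have e2 : star (z n) * b * z n = d * (g n * h * g n) * d := by
        simp only [z, star_mul, (hg n).star_eq, hd.star_eq, hh]; noncomm_ring
      have e3 : g n * h * g n = cfcₙ φ h := hconj _ (hcont n) (hz0 n)
      rw [e2, e3, ← hdc]
      noncomm_ring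
    rw [e1, norm_neg]
    refine (norm_mul_le _ _).trans ?_
    gcongr
    refine le_of_sq_le_sq ?_ (by have := hs n; positivity)
    rw [mul_pow, Real.sq_sqrt zero_le_two]
    refine (norm_sub_mul_sq_le_of_sq_le hd hdc hc hcw hp).trans ?_
    have hid : ContinuousOn (fun t : ℝ => t) (quasispectrum ℝ h) := continuousOn_id
    have e3 : h - cfcₙ φ h * h - h * cfcₙ φ h + cfcₙ φ h * h * cfcₙ φ h
        = cfcₙ (fun t => t - φ t * t - t * φ t + φ t * t * φ t) h := by
      have i1 := hφ.mul hid
      have i2 := hid.mul hφ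
      have i3 := i1.mul hφ
      rw [cfcₙ_add (fun t => t - φ t * t - t * φ t) (fun t => φ t * t * φ t) h
          ((hid.sub i1).sub i2) (by simp) i3 (by simp),
        cfcₙ_sub (fun t => t - φ t * t) (fun t => t * φ t) h (hid.sub i1) (by simp) i2 (by simp),
        cfcₙ_sub (fun t => t) (fun t => φ t * t) h hid rfl i1 (by simp),
        ← hconj φ hφ hφ0, cfcₙ_mul φ (fun t => t) h hφ hφ0 hid rfl,
        cfcₙ_mul (fun t => t) φ h hid rfl hφ hφ0, cfcₙ_id' ℝ h hsa]
    rw [e3]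
    refine norm_cfcₙ_le fun t ht => ?_
    have ht := hspec t ht
    have i1 := mul_approxInvSqrt_sq_le_one (hs n) ht
    have i2 := mul_one_sub_approxInvSqrt_sq_le (hs n) ht
    have i0 : 0 ≤ t * approxInvSqrt (s n) t ^ 2 := by positivity
    have i3 : t - φ t * t - t * φ t + φ t * t * φ t =
        t * (1 - t * approxInvSqrt (s n) t ^ 2) * (1 - t * approxInvSqrt (s n) t ^ 2) := by
      simp only [φ]; ring
    rw [i3, Real.norm_of_nonneg (mul_nonneg (mul_nonneg ht (by linarith)) (by linarith))]
    exact (mul_le_of_le_one_right (mul_nonneg ht (by linarith)) (by linarith)).trans i2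
  rw [tendsto_iff_norm_sub_tendsto_zero]
  refine squeeze_zero (fun n => norm_nonneg _) hbound ?_
  simpa using (hs0.const_mul (√2)).mul_const ‖d‖

/-- Multiplying by a cutoff function supported away from `0` perturbs a positive element little,
and makes it bounded below by a multiple of the square of the cutoff. -/
lemma exists_cutoff {b : A} (hb : 0 ≤ b) {η : ℝ} (hη : 0 < η) :
    ∃ q : A, IsSelfAdjoint q ∧ ‖q‖ ≤ 1 ∧ ‖b - q * b * q‖ ≤ 2 * η ∧ q * q ≤ η⁻¹ • (q * b * q) := by
  let f : ℝ → ℝ := fun t => min 1 (max (t - η) 0 / η)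
  have hspec : ∀ t ∈ quasispectrum ℝ b, 0 ≤ t := fun t ht =>
    quasispectrum_nonneg_of_nonneg b hb t ht
  have hf : Continuous f := by fun_prop
  have hf0 : f 0 = 0 := by simp [f, hη.le]
  have hfn : ∀ t, 0 ≤ f t := fun t => by simp only [f]; positivity
  have hf1 : ∀ t, f t ≤ 1 := fun t => min_le_left _ _
  have hid : Continuous (fun t : ℝ => t) := continuous_id
  have hbb : cfcₙ (fun t : ℝ => t) b = b := cfcₙ_id' ℝ b hb.isSelfAdjoint
  have hconj : cfcₙ f b * b * cfcₙ f b = cfcₙ (fun t => f t * t * f t) b := by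
    rw [cfcₙ_mul (fun t => f t * t) f b (hf.mul hid).continuousOn (by simp) hf.continuousOn hf0,
      cfcₙ_mul f (fun t => t) b hf.continuousOn hf0 hid.continuousOn rfl, hbb]
  have hc3 : Continuous (fun t => f t * t * f t) := (hf.mul hid).mul hf
  refine ⟨cfcₙ f b, cfcₙ_predicate _ b, norm_cfcₙ_le fun t _ => ?_, ?_, ?_⟩
  · rw [Real.norm_of_nonneg (hfn t)]; exact hf1 t
  · rw [hconj]
    nth_rewrite 1 [← hbb]
    rw [← cfcₙ_sub (fun t : ℝ => t) (fun t => f t * t * f t) b hid.continuousOn rfl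
      hc3.continuousOn (by simp)]
    refine norm_cfcₙ_le fun t ht => ?_
    have ht := hspec t ht
    have h1 : f t * f t ≤ 1 := by nlinarith [hfn t, hf1 t]
    have h2 : 0 ≤ t * (f t * f t) := mul_nonneg ht (mul_self_nonneg _)
    rw [Real.norm_of_nonneg (by nlinarith)]
    rcases le_total t (2 * η) with h | h
    · nlinarith
    · have : f t = 1 := by
        refine min_eq_left ?_
        rw [le_div_iff₀ hη]
        exact le_max_of_le_left (by linarith)
      rw [this]; linarith
  · rw [hconj, ← cfcₙ_mul f f b hf.continuousOn hf0 hf.continuousOn hf0,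
      ← cfcₙ_smul η⁻¹ (fun t => f t * t * f t) b hc3.continuousOn (by simp)]
    refine cfcₙ_mono (fun t ht => ?_) (hf.mul hf).continuousOn (continuous_const.mul hc3).continuousOn
      (by simp [hf0]) (by simp [hf0])
    rw [smul_eq_mul]
    rcases le_total t η with h | h
    · have : f t = 0 := by simp [f, max_eq_right (sub_nonpos.mpr h)]
      simp [this]
    · have h1 : 1 ≤ η⁻¹ * t := by rw [inv_mul_eq_div, le_div_iff₀ hη]; linarith
      nlinarith [mul_le_mul_of_nonneg_right h1 (mul_self_nonneg (f t))]

end PositiveFactorization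

/-- For `ε < δ`, the element `(a - δ)₊` has the form `e (a - ε) e` with `e` a self-adjoint
contraction. -/
lemma exists_conjugate_sub_eq {A : Type*} [NonUnitalCStarAlgebra A] {a : A} (ha : IsSelfAdjoint a)
    {δ ε : ℝ} (hε : 0 ≤ ε) (hεδ : ε < δ) :
    ∃ e : A, IsSelfAdjoint e ∧ ‖e‖ ≤ 1 ∧
      cfcₙ (fun t : ℝ => max (t - δ) 0) a = e * a * e - ε • (e * e) := by
  let f : ℝ → ℝ := fun t => √(max (t - δ) 0 / (max t δ - ε))
  have hpos : ∀ t, 0 < max t δ - ε := fun t => by have := le_max_right t δ; linarith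
  have hf : Continuous f := Real.continuous_sqrt.comp <|
    Continuous.div (by fun_prop) (by fun_prop) fun t => (hpos t).ne'
  have hf0 : f 0 = 0 := by
    have : max (0 - δ) 0 = 0 := max_eq_right (by linarith)
    simp only [f, this]; simp
  have hid : Continuous (fun t : ℝ => t) := continuous_id
  refine ⟨cfcₙ f a, cfcₙ_predicate _ a, norm_cfcₙ_le fun t _ => ?_, ?_⟩
  · rw [Real.norm_of_nonneg (Real.sqrt_nonneg _)]
    refine Real.sqrt_le_one.mpr ?_
    rw [div_le_one (hpos t)]
    exact max_le (by have := le_max_left t δ; linarith) (hpos t).le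
  · have e1 : cfcₙ f a * a * cfcₙ f a = cfcₙ (fun t => f t * t * f t) a := by
      rw [cfcₙ_mul (fun t => f t * t) f a (hf.mul hid).continuousOn (by simp) hf.continuousOn hf0,
        cfcₙ_mul f (fun t => t) a hf.continuousOn hf0 hid.continuousOn rfl, cfcₙ_id' ℝ a ha]
    rw [e1, ← cfcₙ_mul f f a hf.continuousOn hf0 hf.continuousOn hf0,
      ← cfcₙ_smul ε (fun t => f t * f t) a (hf.mul hf).continuousOn (by simp [hf0]),
      ← cfcₙ_sub (fun t => f t * t * f t) (fun t => ε • (f t * f t)) a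
        ((hf.mul hid).mul hf).continuousOn (by simp) ((hf.mul hf).const_smul ε).continuousOn
        (by simp [hf0])]
    refine cfcₙ_congr fun t _ => ?_
    have h1 : f t * f t = max (t - δ) 0 / (max t δ - ε) :=
      Real.mul_self_sqrt (div_nonneg (le_max_right _ _) (hpos t).le)
    have h2 : f t * t * f t - ε • (f t * f t) = (f t * f t) * (t - ε) := by
      rw [smul_eq_mul]; ring
    rw [h2, h1]
    rcases le_total t δ with h | h
    · simp [max_eq_right (sub_nonpos.mpr h)]
    · have := hpos t
      rw [max_eq_left h] at this ⊢
      field_simp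

/-- (Rørdam's lemma, exact form.) If `a, b` are positive contractions in a C*-algebra with
`‖a - b‖ < δ/2` for some `0 < δ < 1`, then `(a - δ)₊ = z* b z` for some contraction `z ∈ A`. -/
theorem stmt7 {A : Type*} [NonUnitalCStarAlgebra A] [PartialOrder A] [StarOrderedRing A]
    (a b : A) (ha : 0 ≤ a) (hna : ‖a‖ ≤ 1) (hb : 0 ≤ b) (hnb : ‖b‖ ≤ 1)
    (δ : ℝ) (hδ0 : 0 < δ) (hδ1 : δ < 1) (hclose : ‖a - b‖ < δ / 2) :
    ∃ z : A, ‖z‖ ≤ 1 ∧ cfcₙ (fun t : ℝ => max (t - δ) 0) a = star z * b * z := by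
  obtain ⟨q, hq, hq1, hqb, hqq⟩ := exists_cutoff hb (η := δ / 8) (by linarith)
  have hnorm : ‖a - q * b * q‖ ≤ δ * (3 / 4) := by
    calc ‖a - q * b * q‖ = ‖(a - b) + (b - q * b * q)‖ := by congr 1; abel
      _ ≤ ‖a - b‖ + ‖b - q * b * q‖ := norm_add_le _ _
      _ ≤ δ * (3 / 4) := by linarith
  obtain ⟨e, he, he1, hcut⟩ := exists_conjugate_sub_eq ha.isSelfAdjoint
    (δ := δ) (ε := δ * (3 / 4)) (by linarith) (by linarith)
  have hc : 0 ≤ cfcₙ (fun t : ℝ => max (t - δ) 0) a := cfcₙ_nonneg fun t _ => le_max_right _ _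
  have hw : star (q * e) = e * q := by rw [star_mul, hq.star_eq, he.star_eq]
  have hwb : star (q * e) * b * (q * e) = e * (q * b * q) * e := by rw [hw]; noncomm_ring
  have hle : cfcₙ (fun t : ℝ => max (t - δ) 0) a ≤ star (q * e) * b * (q * e) := by
    have hsa : IsSelfAdjoint (a - q * b * q) :=
      ha.isSelfAdjoint.sub (hq.conjugate_nonneg hb).isSelfAdjoint
    have h1 := CStarAlgebra.star_left_conjugate_le_norm_smul (a := e) (b := a - q * b * q) hsa
    rw [he.star_eq] at h1
    have h2 : ‖a - q * b * q‖ • (e * e) ≤ (δ * (3 / 4)) • (e * e) :=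
      smul_le_smul_of_nonneg_right hnorm he.mul_self_nonneg
    rw [hcut, hwb, sub_le_iff_le_add', ← sub_le_iff_le_add]
    refine le_trans (le_of_eq ?_) (h1.trans h2)
    noncomm_ring
  have hdom : star (q * e) * (q * e) ≤ (δ / 8)⁻¹ • (star (q * e) * b * (q * e)) := by
    have h1 := he.conjugate_le_conjugate hqq
    rw [mul_smul_comm, smul_mul_assoc] at h1
    rw [hwb, hw]
    refine le_trans (le_of_eq ?_) h1
    noncomm_ring
  obtain ⟨z, hz, hzc⟩ := exists_star_mul_mul_eq_of_le hc hle (by positivity) hdom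
  refine ⟨z, hz.trans ((norm_mul_le q e).trans ?_), hzc⟩
  exact mul_le_one₀ hq1 (norm_nonneg _) he1
end

section
/- Let A be a C*-algebra and let a ∈ A₊ be a full element (i.e., the closed two-sided ideal generated by a is all of A). Then for any b ∈ A₊, any ε > 0, and any continuous function g : (0, ∞) → ℝ with g ≥ 0 whose support is contained in [ε, ∞), there exist finitely many elements x₁, ..., x_m ∈ A such that g(b) = ∑_{i=1}^m x_i* a x_i. -/
section PolarDecomposition

open Filter Topology

variable {A : Type*} [NonUnitalCStarAlgebra A]

lemma cfcₙ_mul_self_mul_cfcₙ {M : A} (hM : IsSelfAdjoint M) {f : ℝ → ℝ} (hf : Continuous f)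
    (hf0 : f 0 = 0) : cfcₙ f M * M * cfcₙ f M = cfcₙ (fun t ↦ f t * t * f t) M := by
  rw [cfcₙ_mul (fun t ↦ f t * t) f M, cfcₙ_mul f (fun t ↦ t) M, cfcₙ_id' ℝ M]

variable [PartialOrder A] [StarOrderedRing A]

lemma star_mul_self_mul_cfcₙ_mul (X k : A) {f g : ℝ → ℝ} (hf : Continuous f) (hf0 : f 0 = 0)
    (hg : Continuous g) (hfg : ∀ t, 0 ≤ t → g t = √t * f t) :
    star (X * cfcₙ f (star X * X) * k) * (X * cfcₙ f (star X * X) * k) =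
      star (cfcₙ g (star X * X) * k) * (cfcₙ g (star X * X) * k) := by
  have hM : 0 ≤ star X * X := star_mul_self_nonneg X
  have hF : star (cfcₙ f (star X * X)) = cfcₙ f (star X * X) := IsSelfAdjoint.cfcₙ.star_eq
  have hG : star (cfcₙ g (star X * X)) = cfcₙ g (star X * X) := IsSelfAdjoint.cfcₙ.star_eq
  have hg0 : g 0 = 0 := by simp [hfg 0 le_rfl]
  have key : cfcₙ f (star X * X) * (star X * X) * cfcₙ f (star X * X) =
      cfcₙ g (star X * X) * cfcₙ g (star X * X) := by
    rw [cfcₙ_mul_self_mul_cfcₙ (.of_nonneg hM) hf hf0, ← cfcₙ_mul ..]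
    refine cfcₙ_congr fun t ht ↦ ?_
    have ht0 := quasispectrum_nonneg_of_nonneg _ hM t ht
    simp only [hfg t ht0]
    linear_combination (-(f t) ^ 2) * Real.mul_self_sqrt ht0
  simp only [star_mul, hF, hG]
  calc star k * (cfcₙ f (star X * X) * star X) * (X * cfcₙ f (star X * X) * k)
      = star k * (cfcₙ f (star X * X) * (star X * X) * cfcₙ f (star X * X)) * k := by
        simp only [mul_assoc]
    _ = _ := by rw [key]; simp only [mul_assoc]

lemma norm_sq_mul_cfcₙ_mul_le {X k : A} (hk : IsSelfAdjoint k) (h : k * k ≤ star X * X)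
    {f : ℝ → ℝ} (hf : Continuous f) (hf0 : f 0 = 0) {C : ℝ}
    (hC : ∀ t, 0 ≤ t → (t * f t) ^ 2 ≤ C) :
    ‖X * cfcₙ f (star X * X) * k‖ ^ 2 ≤ C := by
  let g : ℝ → ℝ := fun t ↦ √t * f t
  have hgc : Continuous g := by fun_prop
  have hg0 : g 0 = 0 := by simp [g]
  rw [sq, ← CStarRing.norm_star_mul_self,
    star_mul_self_mul_cfcₙ_mul X k hf hf0 hgc fun _ _ ↦ rfl, CStarRing.norm_star_mul_self,
    ← CStarRing.norm_self_mul_star]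
  have hM : 0 ≤ star X * X := star_mul_self_nonneg X
  generalize star X * X = M at *
  have hG : IsSelfAdjoint (cfcₙ g M) := IsSelfAdjoint.cfcₙ
  have h2 : cfcₙ g M * k * star (cfcₙ g M * k) = cfcₙ g M * (k * k) * cfcₙ g M := by
    simp only [star_mul, hG.star_eq, hk.star_eq, mul_assoc]
  refine (CStarAlgebra.norm_le_norm_of_nonneg_of_le (mul_star_self_nonneg _)
    (h2.trans_le (hG.conjugate_le_conjugate h))).trans ?_
  rw [cfcₙ_mul_self_mul_cfcₙ (.of_nonneg hM) hgc hg0]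
  refine norm_cfcₙ_le fun t ht ↦ ?_
  have ht0 := quasispectrum_nonneg_of_nonneg M hM t ht
  have he : g t * t * g t = (t * f t) ^ 2 := by
    linear_combination (t * (f t) ^ 2) * Real.mul_self_sqrt ht0
  rw [he, Real.norm_of_nonneg (sq_nonneg _)]
  exact hC t ht0

lemma norm_sq_sub_cfcₙ_mul_le {M k : A} (hM : 0 ≤ M) (hk : IsSelfAdjoint k) (h : k * k ≤ M)
    {r : ℝ → ℝ} (hr : Continuous r) (hr0 : r 0 = 0) {C : ℝ}
    (hC : ∀ t, 0 ≤ t → t * (1 - r t) ^ 2 ≤ C) :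
    ‖k - cfcₙ r M * k‖ ^ 2 ≤ C := by
  have hMs : IsSelfAdjoint M := .of_nonneg hM
  have hspec : ∀ t ∈ quasispectrum ℝ M, 0 ≤ t := fun t ht ↦
    quasispectrum_nonneg_of_nonneg M hM t ht
  have hR : star (cfcₙ r M) = cfcₙ r M := (IsSelfAdjoint.cfcₙ (f := r) (a := M)).star_eq
  set R := cfcₙ r M with hRdef
  have h1 : (k - R * k) * star (k - R * k) = k * k - R * (k * k) - k * k * R + R * (k * k) * R := by
    simp only [star_sub, star_mul, hR, hk.star_eq]
    noncomm_ring
  have h2 : k * k - R * (k * k) - k * k * R + R * (k * k) * R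
      ≤ M - R * M - M * R + R * M * R := by
    obtain ⟨z, hz⟩ := CStarAlgebra.nonneg_iff_eq_star_mul_self.mp (sub_nonneg.mpr h)
    have hz' : M = k * k + star z * z := by rw [← hz]; abel
    have hpos : 0 ≤ star (z - z * R) * (z - z * R) := star_mul_self_nonneg _
    rw [← sub_nonneg]
    convert hpos using 1
    rw [star_sub, star_mul, hR]
    rw [hz']
    noncomm_ring
  have h3 : M - R * M - M * R + R * M * R
      = cfcₙ (fun t ↦ t - r t * t - t * r t + r t * t * r t) M := by
    rw [cfcₙ_add .., cfcₙ_sub .., cfcₙ_sub .., cfcₙ_mul .., cfcₙ_mul .., cfcₙ_mul ..,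
      cfcₙ_mul .., cfcₙ_id' ℝ M]
  rw [sq, ← CStarRing.norm_self_mul_star]
  refine (CStarAlgebra.norm_le_norm_of_nonneg_of_le (mul_star_self_nonneg _)
    (h1.trans_le h2)).trans ?_
  rw [h3]
  refine norm_cfcₙ_le fun t ht ↦ ?_
  have he : t - r t * t - t * r t + r t * t * r t = t * (1 - r t) ^ 2 := by ring
  rw [he, Real.norm_of_nonneg (mul_nonneg (hspec t ht) (sq_nonneg _))]
  exact hC t (hspec t ht)

lemma mul_div_add_sq_le {t η : ℝ} (ht : 0 ≤ t) (hη : 0 < η) : t * (η / (t + η)) ^ 2 ≤ η := by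
  rw [div_pow, mul_div_assoc', div_le_iff₀ (by positivity)]
  nlinarith [mul_nonneg ht hη.le, mul_nonneg (mul_nonneg ht ht) hη.le, pow_pos hη 3,
    mul_nonneg ht (sq_nonneg η)]

lemma exists_star_mul_self_eq_of_le {X k : A} (hk : IsSelfAdjoint k) (h : k * k ≤ star X * X) :
    ∃ y : A, star y * y = k * k ∧ ∀ p : A, p * X = X → p * y = y := by
  set M := star X * X with hMdef
  have hM : 0 ≤ M := star_mul_self_nonneg X
  let η : ℕ → ℝ := fun n ↦ 1 / ((n : ℝ) + 1)
  have hη : ∀ n, 0 < η n := fun n ↦ Nat.one_div_pos_of_nat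
  have hηlim : Tendsto η atTop (𝓝 0) := tendsto_one_div_add_atTop_nhds_zero_nat
  have hsqrt : Tendsto (fun n ↦ √(η n)) atTop (𝓝 0) := by simpa using hηlim.sqrt
  let f : ℕ → ℝ → ℝ := fun n t ↦ √t / (|t| + η n)
  let r : ℕ → ℝ → ℝ := fun n t ↦ t / (|t| + η n)
  have hden : ∀ n (t : ℝ), |t| + η n ≠ 0 := fun n t ↦ by have := hη n; positivity
  have hf : ∀ n, Continuous (f n) := fun n ↦
    Real.continuous_sqrt.div (by fun_prop) (hden n)
  have hr : ∀ n, Continuous (r n) := fun n ↦ continuous_id.div (by fun_prop) (hden n)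
  have hf0 : ∀ n, f n 0 = 0 := fun n ↦ by simp [f]
  have hr0 : ∀ n, r n 0 = 0 := fun n ↦ by simp [r]
  have hone : ∀ n t, 0 ≤ t → 1 - r n t = η n / (t + η n) := fun n t ht ↦ by
    have := hden n t
    simp only [r, abs_of_nonneg ht] at this ⊢
    field_simp
    ring
  have hone' : ∀ n t, 0 ≤ t → t * (1 - r n t) ^ 2 ≤ η n := fun n t ht ↦ by
    rw [hone n t ht]; exact mul_div_add_sq_le ht (hη n)
  have hfr : ∀ n t, 0 ≤ t → t * f n t = √t * r n t := fun n t _ ↦ by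
    simp only [f, r]; ring
  let Y : ℕ → A := fun n ↦ X * cfcₙ (f n) M * k
  have hYdiff : ∀ n m, ‖Y n - Y m‖ ^ 2 ≤ max (η n) (η m) := fun n m ↦ by
    have e : Y n - Y m = X * cfcₙ (fun t ↦ f n t - f m t) M * k := by
      rw [cfcₙ_sub (f n) (f m) M (hf n).continuousOn (hf0 n) (hf m).continuousOn (hf0 m)]
      simp only [Y, mul_sub, sub_mul]
    rw [e]
    refine norm_sq_mul_cfcₙ_mul_le hk h ((hf n).sub (hf m)) (by simp [hf0]) fun t ht ↦ ?_
    have e2 : (t * (f n t - f m t)) ^ 2 = t * ((1 - r m t) - (1 - r n t)) ^ 2 := by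
      rw [mul_sub, hfr n t ht, hfr m t ht, ← mul_sub, mul_pow, Real.sq_sqrt ht]
      ring
    refine e2.trans_le ?_
    have hn := hone' n t ht
    have hm := hone' m t ht
    have pn : 0 ≤ 1 - r n t := by rw [hone n t ht]; have := hη n; positivity
    have pm : 0 ≤ 1 - r m t := by rw [hone m t ht]; have := hη m; positivity
    rcases le_total (1 - r n t) (1 - r m t) with hle | hle
    · refine le_trans ?_ (hm.trans (le_max_right _ _))
      refine mul_le_mul_of_nonneg_left (sq_le_sq' ?_ ?_) ht <;> linarith
    · refine le_trans ?_ (hn.trans (le_max_left _ _))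
      refine mul_le_mul_of_nonneg_left (sq_le_sq' ?_ ?_) ht <;> linarith
  have hcauchy : CauchySeq Y := by
    refine cauchySeq_of_le_tendsto_0 (fun n ↦ √(η n)) (fun n m N hn hm ↦ ?_) ?_
    · rw [dist_eq_norm]
      refine Real.le_sqrt_of_sq_le ((hYdiff n m).trans (max_le ?_ ?_))
      · exact Nat.one_div_le_one_div hn
      · exact Nat.one_div_le_one_div hm
    · exact hsqrt
  obtain ⟨y, hy⟩ := cauchySeq_tendsto_of_complete hcauchy
  have hRk : Tendsto (fun n ↦ cfcₙ (r n) M * k) atTop (𝓝 k) := by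
    rw [tendsto_iff_norm_sub_tendsto_zero]
    refine squeeze_zero (fun _ ↦ norm_nonneg _) (g := fun n ↦ √(η n)) (fun n ↦ ?_) ?_
    · rw [norm_sub_rev]
      exact Real.le_sqrt_of_sq_le (norm_sq_sub_cfcₙ_mul_le hM hk h (hr n) (hr0 n) (hone' n))
    · exact hsqrt
  have hYY : ∀ n, star (Y n) * Y n = star (cfcₙ (r n) M * k) * (cfcₙ (r n) M * k) := fun n ↦
    star_mul_self_mul_cfcₙ_mul X k (hf n) (hf0 n) (hr n) fun t ht ↦ by
      simp only [f, r, mul_div_assoc', Real.mul_self_sqrt ht]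
  refine ⟨y, ?_, fun p hp ↦ ?_⟩
  · have t1 : Tendsto (fun n ↦ star (Y n) * Y n) atTop (𝓝 (star y * y)) := hy.star.mul hy
    have t2 := hRk.star.mul hRk
    rw [hk.star_eq] at t2
    exact tendsto_nhds_unique t1 (by simpa only [hYY] using t2)
  · refine tendsto_nhds_unique (tendsto_const_nhds.mul hy) ?_
    simpa only [Y, ← mul_assoc, hp] using hy

end PolarDecomposition

section SumsOfConjugates

variable {A : Type*} [NonUnitalCStarAlgebra A]

/-- The elements of the form `∑ xᵢ* a xᵢ`. -/
def IsSumOfConjugates (a c : A) : Prop :=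
  ∃ (m : ℕ) (x : Fin m → A), c = ∑ i, star (x i) * a * x i

lemma IsSumOfConjugates.single (a x : A) : IsSumOfConjugates a (star x * a * x) :=
  ⟨1, fun _ ↦ x, by simp⟩

lemma IsSumOfConjugates.add {a c d : A} (hc : IsSumOfConjugates a c)
    (hd : IsSumOfConjugates a d) : IsSumOfConjugates a (c + d) := by
  obtain ⟨m, x, rfl⟩ := hc
  obtain ⟨n, y, rfl⟩ := hd
  exact ⟨m + n, Fin.append x y, by simp [Fin.sum_univ_add]⟩

lemma IsSumOfConjugates.conjugate {a c : A} (hc : IsSumOfConjugates a c) (d : A) :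
    IsSumOfConjugates a (star d * c * d) := by
  obtain ⟨m, x, rfl⟩ := hc
  exact ⟨m, fun i ↦ x i * d, by simp only [Finset.mul_sum, Finset.sum_mul, star_mul, mul_assoc]⟩

variable [PartialOrder A] [StarOrderedRing A]

lemma IsSumOfConjugates.nonneg {a c : A} (ha : 0 ≤ a) (hc : IsSumOfConjugates a c) : 0 ≤ c := by
  obtain ⟨m, x, rfl⟩ := hc
  exact Finset.sum_nonneg fun i _ ↦ star_left_conjugate_nonneg ha _

lemma mul_mul_add_star_le {a : A} (ha : 0 ≤ a) (x y : A) :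
    x * a * y + star (x * a * y) ≤ x * a * star x + star y * a * y := by
  have h := star_left_conjugate_nonneg ha (star x - y)
  rw [← sub_nonneg]
  convert h using 1
  simp only [star_mul, star_sub, star_star, (IsSelfAdjoint.of_nonneg ha).star_eq]
  noncomm_ring

lemma exists_isSumOfConjugates_ge {a : A} (ha : 0 ≤ a) {w : A}
    (hw : w ∈ Submodule.span ℂ {z : A | ∃ x y : A, z = x * a * y}) :
    ∃ c, IsSumOfConjugates a c ∧ w + star w ≤ c := by
  suffices ∀ l : ℂ, ∃ c, IsSumOfConjugates a c ∧ l • w + star (l • w) ≤ c by simpa using this 1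
  induction hw using Submodule.span_induction with
  | mem z hz =>
    obtain ⟨x, y, rfl⟩ := hz
    intro l
    refine ⟨_, (IsSumOfConjugates.single a (star (l • x))).add (.single a y), ?_⟩
    simpa only [star_star, smul_mul_assoc] using mul_mul_add_star_le ha (l • x) y
  | zero => exact fun l ↦ ⟨0, ⟨0, Fin.elim0, by simp⟩, by simp⟩
  | add u v _ _ hu hv =>
    intro l
    obtain ⟨c, hc, hcu⟩ := hu l
    obtain ⟨d, hd, hdv⟩ := hv l
    refine ⟨c + d, hc.add hd, ?_⟩
    convert add_le_add hcu hdv using 1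
    rw [smul_add, star_add]
    abel
  | smul r u _ hu =>
    intro l
    simpa only [smul_smul] using hu (l * r)

/-- When `a` is full, every self-adjoint `b` satisfies `b ≤ c + δ` for a suitable sum `c` of
conjugates of `a`; the inequality is stated after conjugation, as `A` need not be unital. -/
lemma exists_isSumOfConjugates_conjugate_le {a : A} (ha : 0 ≤ a)
    (hfull : closure ((Submodule.span ℂ {z : A | ∃ x y : A, z = x * a * y} : Submodule ℂ A)
      : Set A) = Set.univ) {b : A} (hb : IsSelfAdjoint b) {δ : ℝ} (hδ : 0 < δ) :
    ∃ c, IsSumOfConjugates a c ∧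
      ∀ h : A, star h * b * h ≤ star h * c * h + δ • (star h * h) := by
  have hmem : b ∈ closure ((Submodule.span ℂ {z : A | ∃ x y : A, z = x * a * y} :
      Submodule ℂ A) : Set A) := hfull ▸ Set.mem_univ b
  obtain ⟨w, hw, hbw⟩ := Metric.mem_closure_iff.mp hmem δ hδ
  obtain ⟨c, hc, hwc⟩ := exists_isSumOfConjugates_ge ha
    (Submodule.smul_mem _ (1 / 2 : ℂ) hw)
  refine ⟨c, hc, fun h ↦ ?_⟩
  set v : A := (1 / 2 : ℂ) • w + star ((1 / 2 : ℂ) • w) with hv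
  have hvs : IsSelfAdjoint v := IsSelfAdjoint.add_star_self _
  have hbv : b - v = (1 / 2 : ℂ) • ((b - w) + star (b - w)) := by
    rw [star_sub, hb.star_eq, hv, star_smul]
    have : star (1 / 2 : ℂ) = 1 / 2 := by simp
    rw [this]
    module
  have hnorm : ‖b - v‖ ≤ δ := by
    rw [hbv, norm_smul]
    have h1 := norm_add_le (b - w) (star (b - w))
    rw [norm_star, ← dist_eq_norm b w] at h1
    have h2 : ‖(1 / 2 : ℂ)‖ = 1 / 2 := by norm_num
    rw [h2]
    linarith
  have h1 : star h * (b - v) * h ≤ ‖b - v‖ • (star h * h) :=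
    CStarAlgebra.star_left_conjugate_le_norm_smul (hb.sub hvs)
  have h2 : ‖b - v‖ • (star h * h) ≤ δ • (star h * h) :=
    smul_le_smul_of_nonneg_right hnorm (star_mul_self_nonneg h)
  have h3 := star_left_conjugate_le_conjugate hwc h
  calc star h * b * h = star h * v * h + star h * (b - v) * h := by noncomm_ring
    _ ≤ _ := add_le_add h3 (h1.trans h2)

lemma exists_star_mul_mul_eq {c h k : A} (hc : 0 ≤ c) (hk : IsSelfAdjoint k) {δ : ℝ}
    (hδ : 0 < δ) (hle : k * k + δ • (star h * h) ≤ star h * c * h) :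
    ∃ d, star d * c * d = k * k := by
  have hcs : IsSelfAdjoint c := .of_nonneg hc
  have hspec : ∀ t ∈ quasispectrum ℝ c, 0 ≤ t := quasispectrum_nonneg_of_nonneg c hc
  let q : ℝ → ℝ := fun t ↦ √(max (t - δ) 0)
  let s : ℝ → ℝ := fun t ↦ t / (max t δ * √(max t δ))
  have hmax : ∀ t, 0 < max t δ := fun t ↦ lt_max_of_lt_right hδ
  have hq : Continuous q := by fun_prop
  have hs : Continuous s := continuous_id.div (by fun_prop) fun t ↦
    (mul_pos (hmax t) (Real.sqrt_pos.mpr (hmax t))).ne'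
  have hq0 : q 0 = 0 := by simp [q, hδ.le]
  have hs0 : s 0 = 0 := by simp [s]
  have hQ : star (cfcₙ q c) = cfcₙ q c := IsSelfAdjoint.cfcₙ.star_eq
  have hS : star (cfcₙ s c) = cfcₙ s c := IsSelfAdjoint.cfcₙ.star_eq
  have hcut : k * k ≤ star (cfcₙ q c * h) * (cfcₙ q c * h) := by
    have hmin : c - cfcₙ q c * cfcₙ q c = cfcₙ (fun t ↦ t - q t * q t) c := by
      rw [cfcₙ_sub .., cfcₙ_mul .., cfcₙ_id' ℝ c]
    have hnorm : ‖c - cfcₙ q c * cfcₙ q c‖ ≤ δ := by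
      rw [hmin]
      refine norm_cfcₙ_le fun t ht ↦ ?_
      have ht0 := hspec t ht
      rw [Real.mul_self_sqrt (le_max_right _ _), Real.norm_eq_abs, abs_le]
      rcases max_cases (t - δ) 0 with ⟨h1, h2⟩ | ⟨h1, h2⟩ <;> rw [h1] <;>
        constructor <;> linarith
    have h1 : star h * (c - cfcₙ q c * cfcₙ q c) * h ≤ δ • (star h * h) :=
      (CStarAlgebra.star_left_conjugate_le_norm_smul (by rw [hmin]; exact .cfcₙ)).trans
        (smul_le_smul_of_nonneg_right hnorm (star_mul_self_nonneg h))
    have h2 : star h * (c - cfcₙ q c * cfcₙ q c) * h =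
        star h * c * h - star (cfcₙ q c * h) * (cfcₙ q c * h) := by
      rw [star_mul, hQ]
      noncomm_ring
    rw [h2, sub_le_iff_le_add'] at h1
    exact le_of_add_le_add_right (hle.trans h1)
  obtain ⟨y, hy, hyp⟩ := exists_star_mul_self_eq_of_le hk hcut
  have hfix : cfcₙ s c * c * cfcₙ s c * (cfcₙ q c * h) = cfcₙ q c * h := by
    rw [cfcₙ_mul_self_mul_cfcₙ hcs hs hs0, ← mul_assoc, ← cfcₙ_mul ..]
    congr 1
    refine cfcₙ_congr fun t ht ↦ ?_
    rcases le_total t δ with htδ | htδ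
    · simp [q, htδ]
    · have htpos := hδ.trans_le htδ
      have hst : s t * t * s t = 1 := by
        simp only [s, max_eq_left htδ]
        field_simp
        rw [Real.sq_sqrt htpos.le]
      simp only [hst, one_mul]
  refine ⟨cfcₙ s c * y, ?_⟩
  calc star (cfcₙ s c * y) * c * (cfcₙ s c * y)
      = star y * (cfcₙ s c * c * cfcₙ s c * y) := by rw [star_mul, hS]; simp only [mul_assoc]
    _ = k * k := by rw [hyp _ hfix, hy]

end SumsOfConjugates

/-- If `a` is a full positive element of a C*-algebra `A` (the closed two-sided ideal it
generates is all of `A`), then for any `b ∈ A₊`, any `ε > 0`, and any nonnegative continuous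
function `g` vanishing on `(-∞, ε)`, there are `x₁, …, x_m ∈ A` with
`g(b) = ∑ xᵢ* a xᵢ`. -/
theorem stmt11 {A : Type*} [NonUnitalCStarAlgebra A] [PartialOrder A] [StarOrderedRing A]
    (a : A) (ha : 0 ≤ a)
    (hfull : closure ((Submodule.span ℂ {z : A | ∃ x y : A, z = x * a * y} : Submodule ℂ A)
        : Set A) = Set.univ) :
    ∀ b : A, 0 ≤ b → ∀ ε : ℝ, 0 < ε →
      ∀ g : ℝ → ℝ, Continuous g → (∀ t : ℝ, 0 ≤ g t) → (∀ t : ℝ, t < ε → g t = 0) →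
        ∃ (m : ℕ) (x : Fin m → A), cfcₙ g b = ∑ i, star (x i) * a * x i := by
  intro b hb ε hε g hg hg_nonneg hgε
  have hbs : IsSelfAdjoint b := .of_nonneg hb
  have hg0 : g 0 = 0 := hgε 0 hε
  obtain ⟨c, hc, hbc⟩ := exists_isSumOfConjugates_conjugate_le ha hfull hbs
    (show 0 < ε / 4 by positivity)
  have hpos : ∀ t, 0 < max t ε - ε / 2 := fun t ↦ by
    have := le_max_right t ε
    linarith
  let p : ℝ → ℝ := fun t ↦ √(g t / (max t ε - ε / 2))
  have hp : Continuous p := Real.continuous_sqrt.comp (hg.div (by fun_prop) fun t ↦ (hpos t).ne')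
  have hp0 : p 0 = 0 := by simp [p, hg0]
  have hpp : ∀ t, p t * p t = g t / (max t ε - ε / 2) := fun t ↦
    Real.mul_self_sqrt (div_nonneg (hg_nonneg t) (hpos t).le)
  clear_value p
  set h := cfcₙ p b with hh
  have hhs : star h = h := IsSelfAdjoint.cfcₙ.star_eq
  have hk0 : √(g 0) = 0 := by simp [hg0]
  have hkk : cfcₙ (fun t ↦ √(g t)) b * cfcₙ (fun t ↦ √(g t)) b = cfcₙ g b := by
    rw [← cfcₙ_mul ..]
    simp only [Real.mul_self_sqrt (hg_nonneg _)]
  have hdecomp : star h * b * h = cfcₙ g b + (ε / 2) • (star h * h) := by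
    have hsmul : (ε / 2) • (h * h) = cfcₙ (fun t ↦ ε / 2 * (p t * p t)) b := by
      rw [cfcₙ_const_mul (ε / 2) (fun t ↦ p t * p t) b (hp.mul hp).continuousOn (by simp [hp0]),
        cfcₙ_mul p p b hp.continuousOn hp0 hp.continuousOn hp0]
    rw [hhs, hsmul, hh, cfcₙ_mul_self_mul_cfcₙ hbs hp hp0,
      ← cfcₙ_add g (fun t ↦ ε / 2 * (p t * p t)) b hg.continuousOn hg0
        (continuous_const.mul (hp.mul hp)).continuousOn (by simp [hp0])]
    refine cfcₙ_congr fun t _ ↦ ?_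
    have e : p t * t * p t = t * (p t * p t) := by ring
    simp only [e, hpp]
    rcases lt_or_ge t ε with ht | ht
    · simp [hgε t ht]
    · have := (hpos t).ne'
      rw [max_eq_left ht] at this ⊢
      linear_combination div_mul_cancel₀ (g t) this
  have hle : cfcₙ g b + (ε / 4) • (star h * h) ≤ star h * c * h := by
    have h1 := hbc h
    rw [hdecomp, show ε / 2 = ε / 4 + ε / 4 by ring, add_smul, ← add_assoc] at h1
    exact le_of_add_le_add_right h1
  obtain ⟨d, hd⟩ := exists_star_mul_mul_eq (hc.nonneg ha) IsSelfAdjoint.cfcₙ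
    (show 0 < ε / 4 by positivity) (hkk.symm ▸ hle)
  rw [← hkk, ← hd]
  exact hc.conjugate d
end
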